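/- Fix k ∈ ℕ ∪ {∞} and let U be a nonempty open subset of ℝ. The restriction ring homomorphism ψ : C^k(ℝ) → C^k(U) is an epimorphism in the category of commutative rings, and C^k(U), viewed as a module over C^k(ℝ) via ψ, is flat. -/

import Mathlib

noncomputable section

/-- The cozero set of a function. -/
def coz (f : ℝ → ℝ) : Set ℝ := {x | f x ≠ 0}

/-- The ring `C^k(ℝ)` of `k`-times continuously differentiable functions `ℝ → ℝ`,
as a subring of the ring of all functions `ℝ → ℝ` with pointwise operations. -/
def Ck (k : ℕ∞) : Subring (ℝ → ℝ) where
  carrier := {f | ContDiff ℝ k f}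
  one_mem' := show ContDiff ℝ k (fun _ => (1 : ℝ)) from contDiff_const
  mul_mem' := fun {a b} ha hb => show ContDiff ℝ k (a * b) from ContDiff.mul ha hb
  zero_mem' := show ContDiff ℝ k (fun _ => (0 : ℝ)) from contDiff_const
  add_mem' := fun {a b} ha hb => show ContDiff ℝ k (a + b) from ContDiff.add ha hb
  neg_mem' := fun {a} ha => show ContDiff ℝ k (-a) from ContDiff.neg ha

/-- A function `f : U → ℝ` on an open set `U ⊆ ℝ` is `C^k` if some (equivalently,
since `ContDiffOn` only depends on values on `U`, any) extension of it to `ℝ`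
is `ContDiffOn ℝ k` on `U`. -/
def IsCkOn (k : ℕ∞) (U : Set ℝ) (f : ↥U → ℝ) : Prop :=
  ∃ F : ℝ → ℝ, ContDiffOn ℝ k F U ∧ ∀ x : U, F x = f x

/-- The ring `C^k(U)` of `k`-times continuously differentiable functions `U → ℝ`,
as a subring of the ring of all functions `↥U → ℝ` with pointwise operations. -/
def CkOn (k : ℕ∞) (U : Set ℝ) : Subring (↥U → ℝ) where
  carrier := {f | IsCkOn k U f}
  one_mem' := ⟨fun _ => 1, contDiffOn_const, fun _ => rfl⟩
  mul_mem' := fun {a b} ha hb => by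
    obtain ⟨F, hF, hFa⟩ := ha; obtain ⟨G, hG, hGb⟩ := hb
    exact ⟨F * G, hF.mul hG, fun x => by
      simp only [Pi.mul_apply, hFa x, hGb x]⟩
  zero_mem' := ⟨fun _ => 0, contDiffOn_const, fun _ => rfl⟩
  add_mem' := fun {a b} ha hb => by
    obtain ⟨F, hF, hFa⟩ := ha; obtain ⟨G, hG, hGb⟩ := hb
    exact ⟨F + G, hF.add hG, fun x => by
      simp only [Pi.add_apply, hFa x, hGb x]⟩
  neg_mem' := fun {a} ha => by
    obtain ⟨F, hF, hFa⟩ := ha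
    exact ⟨-F, hF.neg, fun x => by simp only [Pi.neg_apply, hFa x]⟩

/-- The restriction ring homomorphism `ψ : C^k(ℝ) → C^k(U)`. -/
def restrictHom (k : ℕ∞) (U : Set ℝ) : Ck k →+* CkOn k U where
  toFun f := ⟨fun x => f.1 x, f.1, ContDiff.contDiffOn f.2, fun _ => rfl⟩
  map_one' := rfl
  map_mul' _ _ := rfl
  map_zero' := rfl
  map_add' _ _ := rfl

instance algebraCkOn (k : ℕ∞) (U : Set ℝ) : Algebra (Ck k) (CkOn k U) :=
  (restrictHom k U).toAlgebra

/-- The multiplicatively closed subset `M = {a ∈ C^k(ℝ) | U ⊆ coz a}`. -/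
def cozSubmonoid (k : ℕ∞) (U : Set ℝ) : Submonoid (Ck k) where
  carrier := {a | U ⊆ coz a.1}
  one_mem' := fun _ _ => one_ne_zero
  mul_mem' := fun {a b} ha hb x hx =>
    show a.1 x * b.1 x ≠ 0 from mul_ne_zero (ha hx) (hb hx)

section Multiplier

open Set Function Filter

variable {E : Type*} [NormedAddCommGroup E] [NormedSpace ℝ E]

theorem contDiff_mul_of_tsupport_subset {k : ℕ∞} {U : Set E} (hU : IsOpen U) {φ F : E → ℝ}
    (hφ : ContDiff ℝ k φ) (hφU : tsupport φ ⊆ U) (hF : ContDiffOn ℝ k F U) :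
    ContDiff ℝ k (φ * F) := by
  refine contDiff_iff_contDiffAt.2 fun x => ?_
  by_cases hx : x ∈ tsupport φ
  · exact hφ.contDiffAt.mul (hF.contDiffAt (hU.mem_nhds (hφU hx)))
  · refine (contDiffAt_const (c := (0 : ℝ))).congr_of_eventuallyEq ?_
    filter_upwards [notMem_tsupport_iff_eventuallyEq.1 hx] with y hy
    simp [hy]

theorem exists_forall_norm_iteratedFDeriv_le_of_hasCompactSupport {k : ℕ∞} {u : E → ℝ}
    (hu : ContDiff ℝ k u) (hc : HasCompactSupport u) (n : ℕ) :
    ∃ R : ℝ, ∀ i ≤ n, (i : ℕ∞) ≤ k → ∀ x, ‖iteratedFDeriv ℝ i u x‖ ≤ R := by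
  have hb (i : ℕ) : ∃ R : ℝ, (i : ℕ∞) ≤ k → ∀ x, ‖iteratedFDeriv ℝ i u x‖ ≤ R := by
    by_cases hi : (i : ℕ∞) ≤ k
    · obtain ⟨R, hR⟩ := (hu.continuous_iteratedFDeriv
        (mod_cast hi)).norm.bddAbove_range_of_hasCompactSupport
        ((hc.iteratedFDeriv i).comp_left norm_zero)
      exact ⟨R, fun _ x => hR (mem_range_self x)⟩
    · exact ⟨0, fun h => absurd h hi⟩
  choose R hR using hb
  obtain ⟨M, hM⟩ := ((Finset.range (n + 1)).image R).bddAbove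
  exact ⟨M, fun i hi hik x => (hR i hik x).trans
    (hM (Finset.mem_coe.2 (Finset.mem_image_of_mem R (Finset.mem_range.2 (by omega)))))⟩

/-- If the constants `r n > 0` are small enough, then `∑ r n * u n` is `C^k` for any sequence of
compactly supported `C^k` functions; finitely many sequences can share the same constants. -/
theorem exists_pos_contDiff_tsum_smul {ι : Type*} [Finite ι] {k : ℕ∞} {u : ι → ℕ → E → ℝ}
    (hu : ∀ j n, ContDiff ℝ k (u j n)) (hc : ∀ j n, HasCompactSupport (u j n)) :
    ∃ r : ℕ → ℝ, (∀ n, 0 < r n) ∧ ∀ j,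
      (∀ x, Summable fun n => r n * u j n x) ∧ ContDiff ℝ k fun x => ∑' n, r n * u j n x := by
  have hbound (n : ℕ) : ∃ r : ℝ, 0 < r ∧ ∀ j, ∀ i ≤ n, (i : ℕ∞) ≤ k → ∀ x,
      ‖iteratedFDeriv ℝ i (r • u j n) x‖ ≤ (1 / 2) ^ n := by
    choose R hR using fun j =>
      exists_forall_norm_iteratedFDeriv_le_of_hasCompactSupport (hu j n) (hc j n) n
    obtain ⟨M, hM⟩ := (finite_range R).bddAbove
    have hM1 : 0 < max M 1 := lt_max_of_lt_right one_pos
    refine ⟨(max M 1)⁻¹ * (1 / 2) ^ n, by positivity, fun j i hi hik x => ?_⟩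
    rw [iteratedFDeriv_const_smul_apply ((hu j n).contDiffAt.of_le (mod_cast hik)), norm_smul,
      Real.norm_of_nonneg (by positivity), mul_right_comm]
    refine mul_le_of_le_one_left (by positivity) ?_
    rw [inv_mul_le_one₀ hM1]
    exact (hR j i hi hik x).trans ((hM (mem_range_self j)).trans (le_max_left _ _))
  choose r hr hrb using hbound
  refine ⟨r, hr, fun j => ⟨fun x => ?_, ?_⟩⟩
  · refine .of_norm_bounded summable_geometric_two fun n => ?_
    simpa using hrb n j 0 (Nat.zero_le n) zero_le x
  · refine contDiff_tsum_of_eventually (f := fun n => r n • u j n) (v := fun _ n => (1 / 2) ^ n)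
      (fun n => (hu j n).const_smul (r n)) (fun _ _ => summable_geometric_two) fun i hik => ?_
    rw [Nat.cofinite_eq_atTop]
    filter_upwards [eventually_ge_atTop i] with n hn
    exact hrb n j i hn (mod_cast hik)

variable [FiniteDimensional ℝ E]

/-- A nonempty open set is covered by the supports of countably many nonnegative smooth functions
with compact support contained in it. -/
theorem IsOpen.exists_seq_contDiff_iUnion_support_eq {U : Set E} (hU : IsOpen U)
    (hne : U.Nonempty) (k : ℕ∞) :
    ∃ g : ℕ → E → ℝ, (∀ n, ContDiff ℝ k (g n)) ∧ (∀ n, HasCompactSupport (g n)) ∧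
      (∀ n, tsupport (g n) ⊆ U) ∧ (∀ n x, 0 ≤ g n x) ∧ ⋃ n, support (g n) = U := by
  choose φ hφU hφc hφ hφr hφ1 using fun x : U =>
    exists_contDiff_tsupport_subset (n := k) (hU.mem_nhds x.2)
  have hcover : ⋃ x, support (φ x) = U := by
    refine Subset.antisymm (iUnion_subset fun x => (subset_tsupport _).trans (hφU x)) fun x hx => ?_
    exact mem_iUnion.2 ⟨⟨x, hx⟩, by simp [hφ1 ⟨x, hx⟩]⟩
  obtain ⟨T, hTc, hT⟩ := TopologicalSpace.isOpen_iUnion_countable (fun x => support (φ x))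
    fun x => (hφ x).continuous.isOpen_support
  rw [hcover] at hT
  have hTne : T.Nonempty := by
    rw [nonempty_iff_ne_empty]
    rintro rfl
    simp only [mem_empty_iff_false, iUnion_of_empty, iUnion_empty] at hT
    exact hne.ne_empty hT.symm
  obtain ⟨e, rfl⟩ := hTc.exists_eq_range hTne
  refine ⟨fun n => φ (e n), fun n => hφ _, fun n => hφc _, fun n => hφU _,
    fun n x => (hφr _ (mem_range_self x)).1, ?_⟩
  rwa [biUnion_range] at hT

/-- Every `C^k` function on a nonempty open set `U` becomes `C^k` on the whole space after
multiplication by a suitable `C^k` function with support `U`. -/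
theorem ContDiffOn.exists_contDiff_mul {k : ℕ∞} {U : Set E} (hU : IsOpen U) (hne : U.Nonempty)
    {F : E → ℝ} (hF : ContDiffOn ℝ k F U) :
    ∃ a : E → ℝ, ContDiff ℝ k a ∧ support a = U ∧ ContDiff ℝ k (a * F) := by
  obtain ⟨g, hg, hgc, hgU, hg0, hcover⟩ := hU.exists_seq_contDiff_iUnion_support_eq hne k
  obtain ⟨r, hr, hsum⟩ := exists_pos_contDiff_tsum_smul
    (u := fun (j : Bool) n => if j then g n else g n * F) (k := k)
    (by
      rintro (_ | _) n
      · simpa using! contDiff_mul_of_tsupport_subset hU (hg n) (hgU n) hF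
      · simpa using! hg n)
    (by
      rintro (_ | _) n
      · simpa using! (hgc n).mul_right
      · simpa using! hgc n)
  have hs : ∀ x, Summable fun n => r n * g n x := by simpa using (hsum true).1
  refine ⟨fun x => ∑' n, r n * g n x, by simpa using (hsum true).2, ?_, ?_⟩
  · ext x
    rw [← hcover, mem_support, mem_iUnion]
    refine ⟨fun h => ?_, fun ⟨n, hn⟩ => ?_⟩
    · contrapose! h
      simp [fun n => notMem_support.1 (h n)]
    · exact ((hs x).tsum_pos (fun i => mul_nonneg (hr i).le (hg0 i x)) n
        (mul_pos (hr n) ((hg0 n x).lt_of_ne' hn))).ne'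
  · convert (hsum false).2 using 2 with x
    simp [← tsum_mul_right, mul_assoc]

end Multiplier

theorem isLocalization_cozSubmonoid (k : ℕ∞) {U : Set ℝ} (hU : IsOpen U) (hne : U.Nonempty) :
    IsLocalization (cozSubmonoid k U) (CkOn k U) := by
  rw [isLocalization_iff]
  refine ⟨fun a => ?_, fun h => ?_, fun {f g} hfg => ?_⟩
  · have ha (x : U) : a.1.1 x ≠ 0 := a.2 x.2
    refine IsUnit.of_mul_eq_one (⟨fun x => (a.1.1 x)⁻¹, fun x => (a.1.1 x)⁻¹,
      (show ContDiff ℝ k a.1.1 from a.1.2).contDiffOn.inv fun x hx => a.2 hx,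
      fun _ => rfl⟩ : CkOn k U) ?_
    exact Subtype.ext (funext fun x => mul_inv_cancel₀ (ha x))
  · obtain ⟨F, hF, hFh⟩ := h.2
    obtain ⟨a, ha, hsupp, haF⟩ := hF.exists_contDiff_mul hU hne
    refine ⟨(⟨a * F, haF⟩, ⟨⟨a, ha⟩, hsupp.ge⟩), Subtype.ext (funext fun x => ?_)⟩
    change h.1 x * a x = a x * F x
    rw [hFh, mul_comm]
  · obtain ⟨a, hsupp, ha, -⟩ := hU.exists_contDiff_support_eq (n := k)
    refine ⟨⟨⟨a, ha⟩, hsupp.ge⟩, Subtype.ext (funext fun x => ?_)⟩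
    change a x * f.1 x = a x * g.1 x
    by_cases hx : x ∈ U
    · exact congrArg (a x * ·) (congrFun (congrArg Subtype.val hfg) ⟨x, hx⟩)
    · rw [← hsupp, Function.notMem_support] at hx
      simp [hx]

/-- The restriction map `ψ : C^k(ℝ) → C^k(U)` (`U` nonempty open) is an
epimorphism in the category of rings and makes `C^k(U)` a flat
`C^k(ℝ)`-module. -/
theorem stmt8 (k : ℕ∞) (U : Set ℝ) (hU : IsOpen U) (hUne : U.Nonempty) :
    (∀ (C : Type) [CommRing C] (f g : CkOn k U →+* C),
        f.comp (restrictHom k U) = g.comp (restrictHom k U) → f = g) ∧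
    Module.Flat (Ck k) (CkOn k U) := by
  have := isLocalization_cozSubmonoid k hU hUne
  exact ⟨fun C _ f g hfg => IsLocalization.ringHom_ext (cozSubmonoid k U) hfg,
    IsLocalization.flat _ (cozSubmonoid k U)⟩
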